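/- arXiv:1801.05589 — 2 statements merged into one kernel-verified Lean document; each statement's English description precedes it below -/
import Mathlib

section
/- Let γ ∈ (0, 1/L), let T be a proximal-gradient map for (f, g, γ), let (α_k) be inertial coefficients with α_k ∈ [0, 1] for all k, and suppose F satisfies the KL property with exponent θ ∈ [1/2, 1) and constant C > 0. Set a := (1 − γL)γ/(2(1 + γL)²). Then the alternated-inertia sequence (y_{2k}) satisfies: F(y_{2k}) is nonincreasing, converges to F⋆, and there exists M ≥ 0 such that for all k: F(y_{2k}) − F⋆ ≤ M·(C²/(C² + a))^k. -/
open scoped RealInnerProductSpace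
open Filter

section ProximalGradient

variable {E : Type*} [NormedAddCommGroup E] [InnerProductSpace ℝ E]

theorem HasGradientAt.hasDerivAt_comp_line [CompleteSpace E] {f : E → ℝ} {v x d : E} {t : ℝ}
    (h : HasGradientAt f v (x + t • d)) :
    HasDerivAt (fun s : ℝ => f (x + s • d)) ⟪v, d⟫ t := by
  have hline : HasDerivAt (fun s : ℝ => x + s • d) d t := by
    simpa using ((hasDerivAt_id t).smul_const d).const_add x
  have hcomp := h.hasFDerivAt.comp_hasDerivAt t hline
  rw [InnerProductSpace.toDual_apply_apply] at hcomp
  exact hcomp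

/-- The gradient inequality for convex functions. -/
theorem ConvexOn.add_inner_gradient_le [CompleteSpace E] {f : E → ℝ} {v x : E}
    (hf : ConvexOn ℝ Set.univ f) (h : HasGradientAt f v x) (w : E) :
    f x + ⟪v, w - x⟫ ≤ f w := by
  have hconv : ConvexOn ℝ Set.univ (fun s : ℝ => f (x + s • (w - x))) := by
    have := hf.comp_affineMap (AffineMap.lineMap x w : ℝ →ᵃ[ℝ] E)
    simpa [Function.comp_def, AffineMap.lineMap_apply, add_comm] using this
  have hderiv : HasDerivAt (fun s : ℝ => f (x + s • (w - x))) ⟪v, w - x⟫ 0 :=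
    HasGradientAt.hasDerivAt_comp_line (by simpa using h)
  have hslope := hconv.le_slope_of_hasDerivAt (Set.mem_univ 0) (Set.mem_univ 1) one_pos hderiv
  simp [slope_def_field] at hslope
  linarith

/-- The descent lemma for functions with Lipschitz gradient. -/
theorem le_add_inner_gradient_add_sq [CompleteSpace E] {f : E → ℝ} {f' : E → E} {L : ℝ}
    (hf : ∀ x, HasGradientAt f (f' x) x) (hlip : ∀ x y, ‖f' x - f' y‖ ≤ L * ‖x - y‖) (x z : E) :
    f z ≤ f x + ⟪f' x, z - x⟫ + L / 2 * ‖z - x‖ ^ 2 := by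
  set d := z - x with hd
  let h : ℝ → ℝ := fun t => f (x + t • d) - t * ⟪f' x, d⟫ - t ^ 2 * (L / 2 * ‖d‖ ^ 2)
  have hderiv : ∀ t, HasDerivAt h
      (⟪f' (x + t • d), d⟫ - ⟪f' x, d⟫ - 2 * t * (L / 2 * ‖d‖ ^ 2)) t := fun t => by
    have h₁ := (hf (x + t • d)).hasDerivAt_comp_line
    have h₂ := (hasDerivAt_id t).mul_const ⟪f' x, d⟫
    have h₃ := (hasDerivAt_pow 2 t).mul_const (L / 2 * ‖d‖ ^ 2)
    exact ((h₁.sub h₂).sub h₃).congr_deriv (by simp)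
  have hanti : AntitoneOn h (Set.Icc 0 1) := by
    refine antitoneOn_of_deriv_nonpos (convex_Icc 0 1)
      (fun t _ => (hderiv t).continuousAt.continuousWithinAt)
      (fun t _ => (hderiv t).differentiableAt.differentiableWithinAt) fun t ht => ?_
    rw [interior_Icc] at ht
    rw [(hderiv t).deriv, ← inner_sub_left]
    have hcs := real_inner_le_norm (f' (x + t • d) - f' x) d
    have hl := hlip (x + t • d) x
    rw [add_sub_cancel_left, norm_smul, Real.norm_of_nonneg ht.1.le] at hl
    nlinarith [mul_le_mul_of_nonneg_right hl (norm_nonneg d)]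
  have := hanti (Set.left_mem_Icc.2 zero_le_one) (Set.right_mem_Icc.2 zero_le_one) zero_le_one
  simp [h, hd] at this
  rw [← hd] at this
  linarith

/-- A minimizer of the proximal objective satisfies the optimality condition `(u - p) / γ ∈ ∂g p`. -/
theorem ConvexOn.add_inner_le_of_prox {g : E → ℝ} (hg : ConvexOn ℝ Set.univ g) {γ : ℝ}
    {p u : E}
    (hp : ∀ w, g p + (1 / (2 * γ)) * ‖p - u‖ ^ 2 ≤ g w + (1 / (2 * γ)) * ‖w - u‖ ^ 2) (w : E) :
    g p + ⟪γ⁻¹ • (u - p), w - p⟫ ≤ g w := by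
  have key : ∀ t ∈ Set.Ioc (0 : ℝ) 1,
      g p + ⟪γ⁻¹ • (u - p), w - p⟫ - g w ≤ t * (1 / (2 * γ) * ‖w - p‖ ^ 2) := by
    rintro t ⟨ht, ht1⟩
    have hmin := hp (p + t • (w - p))
    have hconv := hg.2 (Set.mem_univ p) (Set.mem_univ w) (sub_nonneg.2 ht1) ht.le (by ring)
    have hpt : (1 - t) • p + t • w = p + t • (w - p) := by module
    rw [hpt, smul_eq_mul, smul_eq_mul] at hconv
    have hsq : ‖p + t • (w - p) - u‖ ^ 2
        = ‖p - u‖ ^ 2 - 2 * t * ⟪u - p, w - p⟫ + t ^ 2 * ‖w - p‖ ^ 2 := by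
      rw [show p + t • (w - p) - u = t • (w - p) - (u - p) by abel, norm_sub_sq_real,
        norm_smul, inner_smul_left, real_inner_comm, norm_sub_rev p u, mul_pow, Real.norm_eq_abs,
        sq_abs]
      simp only [conj_trivial]
      ring
    rw [hsq] at hmin
    rw [inner_smul_left, conj_trivial]
    refine le_of_mul_le_mul_left ?_ ht
    have hhalf : 1 / (2 * γ) = γ⁻¹ / 2 := by rw [one_div, mul_inv]; ring
    rw [hhalf] at hmin ⊢
    linarith
  have hlim : Tendsto (fun t : ℝ => t * (1 / (2 * γ) * ‖w - p‖ ^ 2))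
      (nhdsWithin 0 (Set.Ioi 0)) (nhds 0) := by
    have : Continuous fun t : ℝ => t * (1 / (2 * γ) * ‖w - p‖ ^ 2) := by fun_prop
    simpa using (this.tendsto 0).mono_left nhdsWithin_le_nhds
  have := ge_of_tendsto hlim (eventually_of_mem (Ioc_mem_nhdsGT one_pos) key)
  linarith

variable [CompleteSpace E] {f g : E → ℝ} {f' : E → E} {L γ : ℝ}

/-- The fundamental inequality of a proximal-gradient step from `x` to `p`. -/
theorem proxGrad_le (hγ : 0 < γ) (hf_conv : ConvexOn ℝ Set.univ f)
    (hf : ∀ x, HasGradientAt f (f' x) x) (hlip : ∀ x y, ‖f' x - f' y‖ ≤ L * ‖x - y‖)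
    (hg : ConvexOn ℝ Set.univ g) {x p : E}
    (hp : ∀ w, g p + (1 / (2 * γ)) * ‖p - (x - γ • f' x)‖ ^ 2
        ≤ g w + (1 / (2 * γ)) * ‖w - (x - γ • f' x)‖ ^ 2) (w : E) :
    f p + g p + ‖p - w‖ ^ 2 / (2 * γ)
      ≤ f w + g w + ‖x - w‖ ^ 2 / (2 * γ) - (1 - γ * L) / (2 * γ) * ‖p - x‖ ^ 2 := by
  have h₁ := le_add_inner_gradient_add_sq hf hlip x p
  have h₂ := hf_conv.add_inner_gradient_le (hf x) w
  have h₃ := hg.add_inner_le_of_prox hp w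
  have hv : γ⁻¹ • (x - γ • f' x - p) = γ⁻¹ • (x - p) - f' x := by
    rw [sub_right_comm, smul_sub, smul_smul, inv_mul_cancel₀ hγ.ne', one_smul]
  rw [hv, inner_sub_left, inner_smul_left, conj_trivial] at h₃
  have h₄ : ⟪f' x, w - x⟫ = ⟪f' x, w - p⟫ + ⟪f' x, p - x⟫ := by
    rw [← inner_add_right, sub_add_sub_cancel]
  have h₅ : ‖x - w‖ ^ 2 = ‖p - x‖ ^ 2 - 2 * ⟪x - p, w - p⟫ + ‖p - w‖ ^ 2 := by
    rw [show x - w = (x - p) - (w - p) by abel, norm_sub_sq_real, norm_sub_rev x p,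
      norm_sub_rev w p]
  have h₆ : ‖x - w‖ ^ 2 / (2 * γ) - (1 - γ * L) / (2 * γ) * ‖p - x‖ ^ 2
      = L / 2 * ‖p - x‖ ^ 2 - γ⁻¹ * ⟪x - p, w - p⟫ + ‖p - w‖ ^ 2 / (2 * γ) := by
    rw [h₅]
    field_simp
    ring
  linarith

/-- A proximal-gradient step yields an explicit subgradient of `f + g` at its endpoint. -/
theorem exists_subgradient_proxGrad (hγ : 0 < γ) (hf_conv : ConvexOn ℝ Set.univ f)
    (hf : ∀ x, HasGradientAt f (f' x) x) (hlip : ∀ x y, ‖f' x - f' y‖ ≤ L * ‖x - y‖)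
    (hg : ConvexOn ℝ Set.univ g) {x p : E}
    (hp : ∀ w, g p + (1 / (2 * γ)) * ‖p - (x - γ • f' x)‖ ^ 2
        ≤ g w + (1 / (2 * γ)) * ‖w - (x - γ • f' x)‖ ^ 2) :
    ∃ v, (∀ w, f p + g p + ⟪v, w - p⟫ ≤ f w + g w) ∧
      ‖v‖ ≤ (1 + γ * L) / γ * ‖p - x‖ := by
  refine ⟨f' p + γ⁻¹ • (x - γ • f' x - p), fun w => ?_, ?_⟩
  · have h₂ := hf_conv.add_inner_gradient_le (hf p) w
    have h₃ := hg.add_inner_le_of_prox hp w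
    rw [inner_add_left]
    linarith
  · have hv : f' p + γ⁻¹ • (x - γ • f' x - p) = (f' p - f' x) + γ⁻¹ • (x - p) := by
      rw [sub_right_comm, smul_sub, smul_smul, inv_mul_cancel₀ hγ.ne', one_smul]
      abel
    rw [hv]
    refine (norm_add_le _ _).trans ?_
    rw [norm_smul, norm_sub_rev x p, Real.norm_of_nonneg (inv_nonneg.2 hγ.le)]
    calc ‖f' p - f' x‖ + γ⁻¹ * ‖p - x‖ ≤ L * ‖p - x‖ + γ⁻¹ * ‖p - x‖ := by
          gcongr
          exact hlip p x
      _ = (1 + γ * L) / γ * ‖p - x‖ := by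
          field_simp
          ring

/-- Sufficient decrease over an inertial step followed by a proximal-gradient step. -/
theorem alternatedInertia_decrease (hγ : 0 < γ) (hγL : γ * L ≤ 1)
    (hf_conv : ConvexOn ℝ Set.univ f)
    (hf : ∀ x, HasGradientAt f (f' x) x) (hlip : ∀ x y, ‖f' x - f' y‖ ≤ L * ‖x - y‖)
    (hg : ConvexOn ℝ Set.univ g) {T : E → E}
    (hT : ∀ x w, g (T x) + (1 / (2 * γ)) * ‖T x - (x - γ • f' x)‖ ^ 2
        ≤ g w + (1 / (2 * γ)) * ‖w - (x - γ • f' x)‖ ^ 2)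
    {α : ℝ} (hα : α ∈ Set.Icc (0 : ℝ) 1) {u z : E} (hz : z = T u + α • (T u - u)) :
    f (T z) + g (T z) ≤ f u + g u - (1 - γ * L) / (2 * γ) * ‖T z - z‖ ^ 2 := by
  have h₁ := proxGrad_le hγ hf_conv hf hlip hg (hT u) u
  have h₂ := proxGrad_le hγ hf_conv hf hlip hg (hT z) (T u)
  have hzn : ‖z - T u‖ ^ 2 / (2 * γ) ≤ ‖T u - u‖ ^ 2 / (2 * γ) := by
    obtain ⟨hα0, hα1⟩ := hα
    rw [hz, add_sub_cancel_left, norm_smul, Real.norm_of_nonneg hα0]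
    gcongr
    exact mul_le_of_le_one_left (norm_nonneg _) hα1
  have h₃ : 0 ≤ ‖T z - T u‖ ^ 2 / (2 * γ) := by positivity
  have h₄ : 0 ≤ (1 - γ * L) / (2 * γ) * ‖T u - u‖ ^ 2 :=
    mul_nonneg (div_nonneg (sub_nonneg.2 hγL) (by positivity)) (sq_nonneg _)
  simp only [sub_self, norm_zero, ne_eq, OfNat.ofNat_ne_zero, not_false_eq_true, zero_pow,
    zero_div, add_zero] at h₁
  linarith

end ProximalGradient

section Rate

variable {r : ℕ → ℝ} {c s : ℝ}

theorem tendsto_zero_of_add_rpow_le (hr : ∀ k, 0 ≤ r k) (hc : 0 < c) (hs : 0 ≤ s)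
    (hdec : ∀ k, 0 < r (k + 1) → r (k + 1) + c * r (k + 1) ^ s ≤ r k) (hanti : Antitone r) :
    Tendsto r atTop (nhds 0) := by
  obtain ⟨l, hl⟩ : ∃ l, Tendsto r atTop (nhds l) :=
    ⟨_, tendsto_atTop_ciInf hanti ⟨0, Set.forall_mem_range.2 hr⟩⟩
  have hl0 : 0 ≤ l := ge_of_tendsto' hl hr
  rcases hl0.eq_or_lt with rfl | hlpos
  · exact hl
  have hlr : ∀ k, l ≤ r k := hanti.le_of_tendsto hl
  have hstep : ∀ k, r (k + 1) + c * l ^ s ≤ r k := fun k =>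
    le_trans (by gcongr; exact hlr _) (hdec k (hlpos.trans_le (hlr _)))
  have := le_of_tendsto_of_tendsto' ((hl.comp (tendsto_add_atTop_nat 1)).add_const (c * l ^ s))
    hl hstep
  have : 0 < c * l ^ s := by positivity
  linarith

theorem exists_le_mul_pow_of_add_rpow_le (hr : ∀ k, 0 ≤ r k) (hc : 0 < c) (hs : 0 ≤ s)
    (hs1 : s ≤ 1)
    (hdec : ∀ k, 0 < r (k + 1) → r (k + 1) + c * r (k + 1) ^ s ≤ r k) (hanti : Antitone r) :
    ∃ M, 0 ≤ M ∧ ∀ k, r k ≤ M * (1 / (1 + c)) ^ k := by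
  obtain ⟨N, hN⟩ := ((tendsto_zero_of_add_rpow_le hr hc hs hdec hanti).eventually_le_const
    one_pos).exists
  have hq : 0 < 1 / (1 + c) := by positivity
  have hq1 : 1 / (1 + c) ≤ 1 := by
    rw [div_le_one (by positivity)]
    linarith
  set q := 1 / (1 + c) with hq_def
  refine ⟨r 0 / q ^ N, div_nonneg (hr 0) (by positivity), fun k => ?_⟩
  rcases le_total k N with hk | hk
  · refine (hanti (Nat.zero_le k)).trans ?_
    rw [div_mul_eq_mul_div, le_div_iff₀ (by positivity)]
    exact mul_le_mul_of_nonneg_left (pow_le_pow_of_le_one hq.le hq1 hk) (hr 0)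
  · induction k, hk using Nat.le_induction with
    | base =>
      rw [div_mul_cancel₀ _ (by positivity)]
      exact hanti (Nat.zero_le N)
    | succ k hk ih =>
      have hstep : r (k + 1) ≤ r k * q := by
        rcases (hr (k + 1)).eq_or_lt with h0 | hpos
        · rw [← h0]
          exact mul_nonneg (hr k) hq.le
        · have hle1 : r (k + 1) ≤ 1 := (hanti (by lia)).trans hN
          have hpow : r (k + 1) ≤ r (k + 1) ^ s :=
            Real.self_le_rpow_of_le_one hpos.le hle1 hs1
          have hd := hdec k hpos
          rw [hq_def, mul_one_div, le_div_iff₀ (by positivity)]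
          nlinarith [mul_le_mul_of_nonneg_left hpow hc.le]
      calc r (k + 1) ≤ r k * q := hstep
        _ ≤ r 0 / q ^ N * q ^ k * q := by gcongr
        _ = r 0 / q ^ N * q ^ (k + 1) := by rw [pow_succ, mul_assoc]

end Rate

theorem stmt_15
    (n : ℕ) (hn : 0 < n)
    (L γ : ℝ) (hL : 0 < L) (hγ : 0 < γ) (hγ2 : γ < 1 / L)
    (f g : EuclideanSpace ℝ (Fin n) → ℝ)
    (f' : EuclideanSpace ℝ (Fin n) → EuclideanSpace ℝ (Fin n))
    (hf_conv : ConvexOn ℝ Set.univ f)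
    (hf_diff : ∀ x, HasGradientAt f (f' x) x)
    (hf_lip : ∀ x y, ‖f' x - f' y‖ ≤ L * ‖x - y‖)
    (hg_conv : ConvexOn ℝ Set.univ g)
    (F : EuclideanSpace ℝ (Fin n) → ℝ) (hF : F = fun w => f w + g w)
    (Fstar : ℝ) (hFstar_le : ∀ w, Fstar ≤ F w) (hFstar_att : ∃ z, F z = Fstar)
    (T : EuclideanSpace ℝ (Fin n) → EuclideanSpace ℝ (Fin n))
    (hT : ∀ x w, g (T x) + (1 / (2 * γ)) * ‖T x - (x - γ • f' x)‖ ^ 2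
        ≤ g w + (1 / (2 * γ)) * ‖w - (x - γ • f' x)‖ ^ 2)
    (θ C : ℝ) (hθ : θ ∈ Set.Ico (1 / 2 : ℝ) 1) (hC : 0 < C)
    (hKL : ∀ x, F x > Fstar → ∀ v, (∀ w, F w ≥ F x + ⟪v, w - x⟫) →
        ‖v‖ ≥ (1 / C) * (F x - Fstar) ^ (1 - θ))
    (α : ℕ → ℝ) (hα : ∀ k, α k ∈ Set.Icc (0 : ℝ) 1)
    (x₀ : EuclideanSpace ℝ (Fin n))
    (x y : ℕ → EuclideanSpace ℝ (Fin n))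
    (hy0 : y 0 = x₀) (hx0 : x 0 = x₀)
    (hseq : ∀ k, Even k →
        y (k + 1) = T (x k)
      ∧ x (k + 1) = y (k + 1) + α k • (y (k + 1) - y k)
      ∧ y (k + 2) = T (x (k + 1))
      ∧ x (k + 2) = y (k + 2))
    (a : ℝ) (ha : a = (1 - γ * L) * γ / (2 * (1 + γ * L) ^ 2)) :
    (∀ k, F (y (2 * (k + 1))) ≤ F (y (2 * k)))
    ∧ Tendsto (fun k => F (y (2 * k))) atTop (nhds Fstar)
    ∧ ∃ M, 0 ≤ M ∧ ∀ k,
        F (y (2 * k)) - Fstar ≤ M * (C ^ 2 / (C ^ 2 + a)) ^ k := by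
  have hγL : γ * L < 1 := (lt_div_iff₀ hL).1 hγ2
  have hγL0 : 0 < γ * L := mul_pos hγ hL
  have ha0 : 0 < a := by
    rw [ha]
    have : 0 < 1 - γ * L := sub_pos.2 hγL
    positivity
  have hc : 0 < a / C ^ 2 := by positivity
  have hxy : ∀ k, x (2 * k) = y (2 * k) := by
    rintro (_ | k)
    · rw [mul_zero, hx0, hy0]
    · exact (hseq (2 * k) (even_two_mul k)).2.2.2
  have hstep : ∀ k, ∃ z, y (2 * (k + 1)) = T z ∧
      F (T z) ≤ F (y (2 * k)) - (1 - γ * L) / (2 * γ) * ‖T z - z‖ ^ 2 := by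
    intro k
    obtain ⟨h₁, h₂, h₃, -⟩ := hseq (2 * k) (even_two_mul k)
    rw [h₁, hxy] at h₂
    refine ⟨x (2 * k + 1), h₃, ?_⟩
    rw [hF]
    exact alternatedInertia_decrease hγ hγL.le hf_conv hf_diff hf_lip hg_conv hT (hα _) h₂
  have hmono : ∀ k, F (y (2 * (k + 1))) ≤ F (y (2 * k)) := by
    intro k
    obtain ⟨z, hz, hle⟩ := hstep k
    rw [hz]
    refine hle.trans (sub_le_self _ ?_)
    exact mul_nonneg (div_nonneg (sub_nonneg.2 hγL.le) (by positivity)) (sq_nonneg _)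
  let r : ℕ → ℝ := fun k => F (y (2 * k)) - Fstar
  have hr : ∀ k, 0 ≤ r k := fun k => sub_nonneg.2 (hFstar_le _)
  have hanti : Antitone r := antitone_nat_of_succ_le fun k => sub_le_sub_right (hmono k) _
  have hdec : ∀ k, 0 < r (k + 1) →
      r (k + 1) + a / C ^ 2 * r (k + 1) ^ (2 * (1 - θ)) ≤ r k := by
    intro k hpos
    obtain ⟨z, hz, hle⟩ := hstep k
    obtain ⟨v, hv, hvn⟩ :=
      exists_subgradient_proxGrad hγ hf_conv hf_diff hf_lip hg_conv (hT z)
    have hrz : r (k + 1) = F (T z) - Fstar := by rw [← hz]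
    have hkl := hKL (T z) (by rw [hrz] at hpos; exact sub_pos.1 hpos) v
      (by rw [hF]; exact hv)
    rw [← hrz] at hkl
    have hsq : (1 / C * r (k + 1) ^ (1 - θ)) ^ 2 ≤ ((1 + γ * L) / γ * ‖T z - z‖) ^ 2 :=
      pow_le_pow_left₀ (by positivity) (hkl.le.trans hvn) 2
    have hpow : r (k + 1) ^ (2 * (1 - θ)) = (r (k + 1) ^ (1 - θ)) ^ 2 := by
      rw [mul_comm, Real.rpow_mul hpos.le, Real.rpow_ofNat]
    have hbound : a / C ^ 2 * r (k + 1) ^ (2 * (1 - θ))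
        ≤ (1 - γ * L) / (2 * γ) * ‖T z - z‖ ^ 2 := by
      calc a / C ^ 2 * r (k + 1) ^ (2 * (1 - θ))
          = a * (1 / C * r (k + 1) ^ (1 - θ)) ^ 2 := by rw [hpow]; ring
        _ ≤ a * ((1 + γ * L) / γ * ‖T z - z‖) ^ 2 := by gcongr
        _ = (1 - γ * L) / (2 * γ) * ‖T z - z‖ ^ 2 := by
          rw [ha]
          field_simp
    have hrk : r k = F (y (2 * k)) - Fstar := rfl
    linarith
  have hs : 0 ≤ 2 * (1 - θ) := by linarith [hθ.2]
  have hs1 : 2 * (1 - θ) ≤ 1 := by linarith [hθ.1]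
  refine ⟨hmono, ?_, ?_⟩
  · exact tendsto_sub_nhds_zero_iff.1 (tendsto_zero_of_add_rpow_le hr hc hs hdec hanti)
  · have hq : C ^ 2 / (C ^ 2 + a) = 1 / (1 + a / C ^ 2) := by field_simp
    rw [hq]
    exact exists_le_mul_pow_of_add_rpow_le hr hc hs hs1 hdec hanti
end

section
/- Let γ > 0, let f : ℝⁿ → ℝ be convex and L-smooth, let g : ℝⁿ → ℝ be an arbitrary (possibly non-convex) function, and set F := f + g. Fix x ∈ ℝⁿ and let t ∈ ℝⁿ be any minimizer over w of g(w) + (1/(2γ))‖w − (x − γ∇f(x))‖². Then for every y ∈ ℝⁿ: F(t) + ((1 − γL)/(2γ))·‖t − x‖² ≤ F(y) + (1/(2γ))·‖x − y‖². -/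
open scoped RealInnerProductSpace

section Gradient

variable {E : Type*} [NormedAddCommGroup E] [InnerProductSpace ℝ E] [CompleteSpace E]

/-- The derivative of a function along a line is the inner product of its gradient with the
direction. -/
theorem HasGradientAt.hasDerivAt_comp_add_smul {f : E → ℝ} {v x d : E} {s : ℝ}
    (h : HasGradientAt f v (x + s • d)) :
    HasDerivAt (fun r : ℝ => f (x + r • d)) ⟪v, d⟫ s := by
  have hline : HasDerivAt (fun r : ℝ => x + r • d) d s := by
    simpa using ((hasDerivAt_id s).smul_const d).const_add x
  simpa [Function.comp_def] using h.hasFDerivAt.comp_hasDerivAt s hline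

/-- First-order characterization: a convex function lies above its tangents. -/
theorem ConvexOn.add_inner_le_of_hasGradientAt {f : E → ℝ} {v x : E}
    (hf : ConvexOn ℝ Set.univ f) (h : HasGradientAt f v x) (y : E) :
    f x + ⟪v, y - x⟫ ≤ f y := by
  have hconv : ConvexOn ℝ Set.univ (fun r : ℝ => f (x + r • (y - x))) := by
    have := hf.comp_affineMap (AffineMap.lineMap x y : ℝ →ᵃ[ℝ] E)
    simpa [Function.comp_def, AffineMap.lineMap_apply, add_comm] using this
  have hderiv : HasDerivAt (fun r : ℝ => f (x + r • (y - x))) ⟪v, y - x⟫ 0 :=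
    HasGradientAt.hasDerivAt_comp_add_smul (by simpa using h)
  have hslope := hconv.le_slope_of_hasDerivAt (Set.mem_univ 0) (Set.mem_univ 1) one_pos hderiv
  simp [slope_def_field] at hslope
  linarith

/-- The descent lemma for functions with Lipschitz gradient. -/
theorem le_add_inner_add_of_lipschitz_gradient {f : E → ℝ} {f' : E → E} {L : ℝ}
    (hf : ∀ x, HasGradientAt f (f' x) x) (hL : ∀ x y, ‖f' x - f' y‖ ≤ L * ‖x - y‖) (x y : E) :
    f y ≤ f x + ⟪f' x, y - x⟫ + L / 2 * ‖y - x‖ ^ 2 := by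
  set d := y - x with hd
  have hderiv (s : ℝ) : HasDerivAt
      (fun r : ℝ => f (x + r • d) - r * ⟪f' x, d⟫ - L / 2 * ‖d‖ ^ 2 * r ^ 2)
      (⟪f' (x + s • d), d⟫ - ⟪f' x, d⟫ - L * ‖d‖ ^ 2 * s) s := by
    have hquad := ((hasDerivAt_id s).pow 2).const_mul (L / 2 * ‖d‖ ^ 2)
    have hlin := (hasDerivAt_id s).mul_const ⟪f' x, d⟫
    refine (((hf (x + s • d)).hasDerivAt_comp_add_smul.sub hlin).sub hquad).congr_deriv ?_
    simp
    ring
  have hanti : AntitoneOn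
      (fun r : ℝ => f (x + r • d) - r * ⟪f' x, d⟫ - L / 2 * ‖d‖ ^ 2 * r ^ 2) (Set.Icc 0 1) := by
    refine antitoneOn_of_deriv_nonpos (convex_Icc 0 1)
      (fun s _ => (hderiv s).continuousAt.continuousWithinAt)
      (fun s _ => (hderiv s).differentiableAt.differentiableWithinAt) fun s hs => ?_
    rw [interior_Icc] at hs
    rw [(hderiv s).deriv, ← inner_sub_left]
    have hlip : ‖f' (x + s • d) - f' x‖ ≤ L * (s * ‖d‖) := by
      simpa [norm_smul, abs_of_pos hs.1] using hL (x + s • d) x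
    have hcs := real_inner_le_norm (f' (x + s • d) - f' x) d
    nlinarith [mul_le_mul_of_nonneg_right hlip (norm_nonneg d)]
  have h := hanti (Set.left_mem_Icc.2 zero_le_one) (Set.right_mem_Icc.2 zero_le_one) zero_le_one
  simp [hd] at h
  linarith

end Gradient

theorem stmt_17
    (n : ℕ) (hn : 0 < n)
    (L γ : ℝ) (hL : 0 < L) (hγ : 0 < γ)
    (f g : EuclideanSpace ℝ (Fin n) → ℝ)
    (f' : EuclideanSpace ℝ (Fin n) → EuclideanSpace ℝ (Fin n))
    (hf_conv : ConvexOn ℝ Set.univ f)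
    (hf_diff : ∀ x, HasGradientAt f (f' x) x)
    (hf_lip : ∀ x y, ‖f' x - f' y‖ ≤ L * ‖x - y‖)
    (x t : EuclideanSpace ℝ (Fin n))
    (ht : ∀ w, g t + (1 / (2 * γ)) * ‖t - (x - γ • f' x)‖ ^ 2
        ≤ g w + (1 / (2 * γ)) * ‖w - (x - γ • f' x)‖ ^ 2) :
    ∀ y, (f t + g t) + ((1 - γ * L) / (2 * γ)) * ‖t - x‖ ^ 2
      ≤ (f y + g y) + (1 / (2 * γ)) * ‖x - y‖ ^ 2 := by
  intro y
  have hexpand (w : EuclideanSpace ℝ (Fin n)) :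
      1 / (2 * γ) * ‖w - (x - γ • f' x)‖ ^ 2 =
        1 / (2 * γ) * ‖w - x‖ ^ 2 + ⟪f' x, w - x⟫ + γ / 2 * ‖f' x‖ ^ 2 := by
    rw [← sub_add, norm_add_sq_real, norm_smul, inner_smul_right, real_inner_comm, mul_pow,
      Real.norm_eq_abs, sq_abs]
    field_simp
  have hprox := ht y
  rw [hexpand t, hexpand y] at hprox
  have hdescent := le_add_inner_add_of_lipschitz_gradient hf_diff hf_lip x t
  have hconv := hf_conv.add_inner_le_of_hasGradientAt (hf_diff x) y
  have hcoef : (1 - γ * L) / (2 * γ) * ‖t - x‖ ^ 2 =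
      1 / (2 * γ) * ‖t - x‖ ^ 2 - L / 2 * ‖t - x‖ ^ 2 := by
    field_simp
  rw [hcoef, norm_sub_rev x y]
  linarith
end
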